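/- For every n ≥ 1 and t < 0, the auxiliary quantities r*_n and r_n are expressed in terms of H_n and its derivative by r*_n = −[n(n+β+γ) + (t−1)H_n′ − H_n]/(2n+α+β+γ) and r_n = [n(n+α+γ) − tH_n′ + H_n]/(2n+α+β+γ). -/

import Mathlib

open MeasureTheory Real

/-- The generalized Jacobi weight `w(x;t) = (x-t)^γ x^α (1-x)^β`. -/
noncomputable def genJacobiWeight (α β γ t x : ℝ) : ℝ :=
  (x - t) ^ γ * x ^ α * (1 - x) ^ β

/-- The Hankel determinant `D_n(t)` of the moments of the generalized Jacobi weight. -/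
noncomputable def hankelDet (α β γ : ℝ) (n : ℕ) (t : ℝ) : ℝ :=
  Matrix.det (Matrix.of fun j k : Fin n =>
    ∫ x in (0:ℝ)..1, x ^ ((j : ℕ) + (k : ℕ)) * genJacobiWeight α β γ t x)

open Polynomial Set Filter Topology

/-- The moment functional `Q ↦ ∫₀¹ Q(x) w(x;t) dx` of the generalized Jacobi weight. -/
noncomputable def jacobiFunctional (α β γ t : ℝ) : ℝ[X] →ₗ[ℝ] ℝ :=
  Polynomial.lsum fun k => LinearMap.toSpanSingleton ℝ ℝ
    (∫ x in (0:ℝ)..1, x ^ k * genJacobiWeight α β γ t x)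

theorem jacobiFunctional_apply (α β γ t : ℝ) (Q : ℝ[X]) :
    jacobiFunctional α β γ t Q =
      ∑ k ∈ Q.support, Q.coeff k * ∫ x in (0:ℝ)..1, x ^ k * genJacobiWeight α β γ t x := by
  simp [jacobiFunctional, Polynomial.lsum, Polynomial.sum_def]

theorem jacobiFunctional_X_pow (α β γ t : ℝ) (k : ℕ) :
    jacobiFunctional α β γ t (X ^ k) =
      ∫ x in (0:ℝ)..1, x ^ k * genJacobiWeight α β γ t x := by
  rw [jacobiFunctional_apply, support_X_pow]
  simp

section Weight

variable {α β γ t : ℝ}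

theorem continuousOn_rpow_sub (γ : ℝ) (ht : t < 0) :
    ContinuousOn (fun x : ℝ => (x - t) ^ γ) (Icc 0 1) :=
  ContinuousOn.rpow_const (by fun_prop) fun x hx => Or.inl (by linarith [hx.1])

theorem intervalIntegrable_rpow_mul_one_sub_rpow (hα : -1 < α) (hβ : -1 < β) :
    IntervalIntegrable (fun x : ℝ => x ^ α * (1 - x) ^ β) volume 0 1 := by
  refine IntervalIntegrable.trans (b := 1 / 2) ?_ ?_
  · refine (intervalIntegral.intervalIntegrable_rpow' hα).mul_continuousOn
      (ContinuousOn.rpow_const (by fun_prop) fun x hx => Or.inl ?_)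
    rw [uIcc_of_le (by norm_num)] at hx
    linarith [hx.2]
  · have h1 : IntervalIntegrable (fun x : ℝ => (1 - x) ^ β) volume (1 / 2) 1 := by
      have := (intervalIntegral.intervalIntegrable_rpow' (a := 1 / 2) (b := 0) hβ).comp_sub_left 1
      norm_num at this
      simpa using this
    refine h1.continuousOn_mul (ContinuousOn.rpow_const (by fun_prop) fun x hx => Or.inl ?_)
    rw [uIcc_of_le (by norm_num)] at hx
    linarith [hx.1]

theorem intervalIntegrable_eval_mul_genJacobiWeight (hα : -1 < α) (hβ : -1 < β) (ht : t < 0)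
    (Q : ℝ[X]) :
    IntervalIntegrable (fun x => Q.eval x * genJacobiWeight α β γ t x) volume 0 1 := by
  have h := (intervalIntegrable_rpow_mul_one_sub_rpow hα hβ).continuousOn_mul
    (g := fun x => Q.eval x * (x - t) ^ γ) (by
      rw [uIcc_of_le zero_le_one]
      exact Q.continuous.continuousOn.mul (continuousOn_rpow_sub γ ht))
  refine h.congr fun x _ => ?_
  simp only [genJacobiWeight]
  ring

theorem jacobiFunctional_eq_integral (hα : -1 < α) (hβ : -1 < β) (ht : t < 0) (Q : ℝ[X]) :
    jacobiFunctional α β γ t Q = ∫ x in (0:ℝ)..1, Q.eval x * genJacobiWeight α β γ t x := by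
  simp_rw [jacobiFunctional_apply, ← intervalIntegral.integral_const_mul]
  rw [← intervalIntegral.integral_finsetSum]
  · refine intervalIntegral.integral_congr fun x _ => ?_
    simp only [eval_eq_sum, Polynomial.sum_def, Finset.sum_mul, mul_assoc]
  · intro k _
    simpa using (intervalIntegrable_eval_mul_genJacobiWeight (γ := γ) hα hβ ht (X ^ k)).const_mul
      (Q.coeff k)

theorem genJacobiWeight_sub_one_left {x : ℝ} (hx : 0 < x) :
    genJacobiWeight (α - 1) β γ t x = genJacobiWeight α β γ t x / x := by
  simp only [genJacobiWeight, rpow_sub_one hx.ne']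
  ring

theorem genJacobiWeight_sub_one_right {x : ℝ} (hx : x < 1) :
    genJacobiWeight α (β - 1) γ t x = genJacobiWeight α β γ t x / (1 - x) := by
  simp only [genJacobiWeight, rpow_sub_one (sub_pos.2 hx).ne']
  ring

theorem genJacobiWeight_sub_one_shift {x : ℝ} (hx : t < x) :
    genJacobiWeight α β (γ - 1) t x = genJacobiWeight α β γ t x / (x - t) := by
  simp only [genJacobiWeight, rpow_sub_one (sub_pos.2 hx).ne']
  ring

theorem jacobiFunctional_X_mul (hα : 0 < α) (hβ : -1 < β) (ht : t < 0) (Q : ℝ[X]) :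
    jacobiFunctional (α - 1) β γ t (X * Q) = jacobiFunctional α β γ t Q := by
  rw [jacobiFunctional_eq_integral (by linarith) hβ ht,
    jacobiFunctional_eq_integral (by linarith) hβ ht]
  refine intervalIntegral.integral_congr_Ioo_of_le zero_le_one fun x hx => ?_
  have := hx.1.ne'
  simp only [eval_mul, eval_X, genJacobiWeight_sub_one_left hx.1]
  field_simp

theorem jacobiFunctional_one_sub_X_mul (hα : -1 < α) (hβ : 0 < β) (ht : t < 0) (Q : ℝ[X]) :
    jacobiFunctional α (β - 1) γ t ((1 - X) * Q) = jacobiFunctional α β γ t Q := by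
  rw [jacobiFunctional_eq_integral hα (by linarith) ht,
    jacobiFunctional_eq_integral hα (by linarith) ht]
  refine intervalIntegral.integral_congr_Ioo_of_le zero_le_one fun x hx => ?_
  have := (sub_pos.2 hx.2).ne'
  simp only [eval_mul, eval_sub, eval_one, eval_X, genJacobiWeight_sub_one_right hx.2]
  field_simp

theorem jacobiFunctional_X_sub_C_mul (hα : -1 < α) (hβ : -1 < β) (ht : t < 0) (Q : ℝ[X]) :
    jacobiFunctional α β (γ - 1) t ((X - C t) * Q) = jacobiFunctional α β γ t Q := by
  rw [jacobiFunctional_eq_integral hα hβ ht, jacobiFunctional_eq_integral hα hβ ht]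
  refine intervalIntegral.integral_congr_Ioo_of_le zero_le_one fun x hx => ?_
  have := (sub_pos.2 (ht.trans hx.1)).ne'
  simp only [eval_mul, eval_sub, eval_C, eval_X, genJacobiWeight_sub_one_shift (ht.trans hx.1)]
  field_simp

/-- Integration by parts against the generalized Jacobi weight. -/
theorem jacobiFunctional_derivative (hα : 0 < α) (hβ : 0 < β) (ht : t < 0) (Q : ℝ[X]) :
    jacobiFunctional α β γ t (derivative Q) + γ * jacobiFunctional α β (γ - 1) t Q
      + α * jacobiFunctional (α - 1) β γ t Q - β * jacobiFunctional α (β - 1) γ t Q = 0 := by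
  have hα' : -1 < α := by linarith
  have hβ' : -1 < β := by linarith
  have i0 := intervalIntegrable_eval_mul_genJacobiWeight (γ := γ) hα' hβ' ht (derivative Q)
  have i1 := (intervalIntegrable_eval_mul_genJacobiWeight (γ := γ - 1) hα' hβ' ht Q).const_mul γ
  have i2 := (intervalIntegrable_eval_mul_genJacobiWeight (α := α - 1) (γ := γ)
    (by linarith) hβ' ht Q).const_mul α
  have i3 := (intervalIntegrable_eval_mul_genJacobiWeight (β := β - 1) (γ := γ) hα'
    (by linarith) ht Q).const_mul β
  rw [jacobiFunctional_eq_integral hα' hβ' ht, jacobiFunctional_eq_integral hα' hβ' ht,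
    jacobiFunctional_eq_integral (by linarith) hβ' ht,
    jacobiFunctional_eq_integral hα' (by linarith) ht,
    ← intervalIntegral.integral_const_mul, ← intervalIntegral.integral_const_mul,
    ← intervalIntegral.integral_const_mul, ← intervalIntegral.integral_add i0 i1,
    ← intervalIntegral.integral_add (i0.add i1) i2,
    ← intervalIntegral.integral_sub ((i0.add i1).add i2) i3]
  have key := intervalIntegral.integral_eq_sub_of_hasDerivAt_of_le zero_le_one
    (f := fun x => Q.eval x * genJacobiWeight α β γ t x) ?_ ?_ (((i0.add i1).add i2).sub i3)
  · refine key.trans ?_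
    simp [genJacobiWeight, zero_rpow hα.ne', zero_rpow hβ.ne']
  · refine Q.continuous.continuousOn.mul (((continuousOn_rpow_sub γ ht).mul ?_).mul ?_)
    · exact ContinuousOn.rpow_const (by fun_prop) fun x _ => Or.inr hα.le
    · exact ContinuousOn.rpow_const (by fun_prop) fun x _ => Or.inr hβ.le
  · intro x hx
    have hx0 := hx.1
    have hx1 := sub_pos.2 hx.2
    have hxt := sub_pos.2 (ht.trans hx.1)
    have d1 : HasDerivAt (fun y : ℝ => (y - t) ^ γ) (1 * γ * (x - t) ^ (γ - 1)) x :=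
      ((hasDerivAt_id x).sub_const t).rpow_const (Or.inl hxt.ne')
    have d2 : HasDerivAt (fun y : ℝ => y ^ α) (1 * α * x ^ (α - 1)) x :=
      (hasDerivAt_id x).rpow_const (Or.inl hx0.ne')
    have d3 : HasDerivAt (fun y : ℝ => (1 - y) ^ β) (-1 * β * (1 - x) ^ (β - 1)) x :=
      ((hasDerivAt_id x).const_sub 1).rpow_const (Or.inl hx1.ne')
    refine ((Q.hasDerivAt x).mul ((d1.mul d2).mul d3)).congr_deriv ?_
    simp only [genJacobiWeight, Pi.mul_apply]
    ring

theorem hasDerivAt_moment (hα : -1 < α) (hβ : -1 < β) (ht : t < 0) (k : ℕ) :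
    HasDerivAt (fun s => ∫ x in (0:ℝ)..1, x ^ k * genJacobiWeight α β γ s x)
      (-γ * ∫ x in (0:ℝ)..1, x ^ k * genJacobiWeight α β (γ - 1) t x) t := by
  obtain ⟨B, hB⟩ : ∃ B : ℝ, ∀ q ∈ Icc (2 * t) (t / 2) ×ˢ Icc (0:ℝ) 1,
      ‖-γ * (q.2 ^ k * (q.2 - q.1) ^ (γ - 1))‖ ≤ B := by
    refine (isCompact_Icc.prod isCompact_Icc).exists_bound_of_continuousOn ?_
    refine continuousOn_const.mul (ContinuousOn.mul (by fun_prop)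
      (ContinuousOn.rpow_const (by fun_prop) fun q hq => Or.inl ?_))
    have h1 := hq.1.2
    have h2 := hq.2.1
    have : 0 < q.2 - q.1 := by linarith
    exact this.ne'
  have hint (γ' : ℝ) {s : ℝ} (hs : s < 0) :
      IntervalIntegrable (fun x => x ^ k * genJacobiWeight α β γ' s x) volume 0 1 := by
    simpa using intervalIntegrable_eval_mul_genJacobiWeight (γ := γ') hα hβ hs (X ^ k)
  rw [← intervalIntegral.integral_const_mul]
  refine (intervalIntegral.hasDerivAt_integral_of_dominated_loc_of_deriv_le
    (F := fun s x => x ^ k * genJacobiWeight α β γ s x)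
    (F' := fun s x => -γ * (x ^ k * genJacobiWeight α β (γ - 1) s x))
    (s := Icc (2 * t) (t / 2)) (bound := fun x => B * (x ^ α * (1 - x) ^ β))
    (Icc_mem_nhds (by linarith) (by linarith)) ?_ (hint γ ht)
    ((hint (γ - 1) ht).const_mul _).aestronglyMeasurable_restrict_uIoc
    ?_ ((intervalIntegrable_rpow_mul_one_sub_rpow hα hβ).const_mul B) ?_).2
  · filter_upwards [Iio_mem_nhds ht] with s hs
    exact (hint γ hs).aestronglyMeasurable_restrict_uIoc
  · refine Eventually.of_forall fun x hx s hs => ?_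
    rw [uIoc_of_le zero_le_one] at hx
    have h0 : 0 ≤ x ^ α * (1 - x) ^ β :=
      mul_nonneg (rpow_nonneg hx.1.le _) (rpow_nonneg (by linarith [hx.2]) _)
    have h1 : -γ * (x ^ k * genJacobiWeight α β (γ - 1) s x) =
        -γ * (x ^ k * (x - s) ^ (γ - 1)) * (x ^ α * (1 - x) ^ β) := by
      simp only [genJacobiWeight]; ring
    rw [h1, norm_mul, norm_of_nonneg h0]
    exact mul_le_mul_of_nonneg_right (hB (s, x) ⟨hs, hx.1.le, hx.2⟩) h0
  · refine Eventually.of_forall fun x hx s hs => ?_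
    rw [uIoc_of_le zero_le_one] at hx
    have hxs : 0 < x - s := by linarith [hx.1, hs.2]
    have d1 : HasDerivAt (fun y : ℝ => (x - y) ^ γ) (-1 * γ * (x - s) ^ (γ - 1)) s :=
      ((hasDerivAt_id s).const_sub x).rpow_const (Or.inl hxs.ne')
    refine (((d1.mul_const (x ^ α)).mul_const ((1 - x) ^ β)).const_mul (x ^ k)).congr_deriv ?_
    simp only [genJacobiWeight]
    ring

theorem hasDerivAt_jacobiFunctional (hα : -1 < α) (hβ : -1 < β) (ht : t < 0) (Q : ℝ[X]) :
    HasDerivAt (fun s => jacobiFunctional α β γ s Q)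
      (-γ * jacobiFunctional α β (γ - 1) t Q) t := by
  simp_rw [jacobiFunctional_apply]
  refine (HasDerivAt.fun_sum fun k _ =>
    (hasDerivAt_moment (γ := γ) hα hβ ht k).const_mul (Q.coeff k)).congr_deriv ?_
  rw [Finset.mul_sum]
  exact Finset.sum_congr rfl fun k _ => by ring

end Weight

theorem Polynomial.coeff_X_mul_derivative (Q : ℝ[X]) (k : ℕ) :
    (X * derivative Q).coeff k = k * Q.coeff k := by
  cases k with
  | zero => simp
  | succ k => rw [coeff_X_mul, coeff_derivative]; push_cast; ring

theorem Polynomial.degree_X_mul_lt {Q : ℝ[X]} {n : ℕ} (hQ : Q.degree < (n : ℕ)) :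
    (X * Q).degree < ((n + 1 : ℕ) : WithBot ℕ) := by
  rw [degree_lt_iff_coeff_zero] at hQ ⊢
  intro k hk
  obtain ⟨k, rfl⟩ : ∃ j, k = j + 1 := ⟨k - 1, by omega⟩
  rw [coeff_X_mul, hQ k (by omega)]

/-- `P` is the sequence of monic orthogonal polynomials of the functional `L`, with squared
norms `h`. -/
structure IsMonicOrthogonal (L : ℝ[X] →ₗ[ℝ] ℝ) (P : ℕ → ℝ[X]) (h : ℕ → ℝ) : Prop where
  monic : ∀ n, (P n).Monic
  natDegree_eq : ∀ n, (P n).natDegree = n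
  apply_mul : ∀ m n, L (P m * P n) = if m = n then h n else 0

namespace IsMonicOrthogonal

variable {L : ℝ[X] →ₗ[ℝ] ℝ} {P : ℕ → ℝ[X]} {h : ℕ → ℝ}

theorem coeff_self (hP : IsMonicOrthogonal L P h) (n : ℕ) : (P n).coeff n = 1 := by
  simpa [hP.natDegree_eq] using (hP.monic n).coeff_natDegree

theorem degree_eq (hP : IsMonicOrthogonal L P h) (n : ℕ) : (P n).degree = n := by
  rw [degree_eq_natDegree (hP.monic n).ne_zero, hP.natDegree_eq]

theorem degree_sub_lt (hP : IsMonicOrthogonal L P h) {Q : ℝ[X]} {n : ℕ}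
    (hQ : Q.degree < ((n + 1 : ℕ) : WithBot ℕ)) : (Q - Q.coeff n • P n).degree < n := by
  rw [degree_lt_iff_coeff_zero] at hQ ⊢
  intro k hk
  rcases hk.eq_or_lt with rfl | hk
  · simp [hP.coeff_self]
  · have : (P n).coeff k = 0 := coeff_eq_zero_of_natDegree_lt (by rwa [hP.natDegree_eq])
    simp [hQ k hk, this]

theorem apply_mul_of_degree_lt (hP : IsMonicOrthogonal L P h) {n : ℕ} {Q : ℝ[X]}
    (hQ : Q.degree < n) : L (P n * Q) = 0 := by
  suffices H : ∀ m ≤ n, ∀ Q : ℝ[X], Q.degree < m → L (P n * Q) = 0 from H n le_rfl Q hQ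
  intro m
  induction m with
  | zero =>
    intro _ Q hQ
    have : Q = 0 := by simpa using hQ
    simp [this]
  | succ m ih =>
    intro hm Q hQ
    have h1 := ih (by omega) _ (hP.degree_sub_lt hQ)
    rw [mul_sub, mul_smul_comm, map_sub, map_smul, hP.apply_mul, if_neg (by omega)] at h1
    simpa using h1

theorem apply_mul_of_degree_lt_add_two (hP : IsMonicOrthogonal L P h) {n : ℕ} {Q : ℝ[X]}
    (hQ : Q.degree < ((n + 2 : ℕ) : WithBot ℕ)) :
    L (P n * Q) = (Q.coeff n - Q.coeff (n + 1) * (P (n + 1)).coeff n) * h n := by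
  have h1 := hP.apply_mul_of_degree_lt (hP.degree_sub_lt (hP.degree_sub_lt hQ))
  simp only [mul_sub, mul_smul_comm, map_sub, map_smul, hP.apply_mul, coeff_sub, coeff_smul,
    smul_eq_mul] at h1
  simp only [if_neg (Nat.succ_ne_self n).symm, if_true, mul_zero, sub_zero] at h1
  linarith

theorem degree_X_mul_derivative_lt (hP : IsMonicOrthogonal L P h) (n : ℕ) :
    (X * derivative (P n)).degree < ((n + 1 : ℕ) : WithBot ℕ) := by
  rw [degree_lt_iff_coeff_zero]
  intro k hk
  rw [coeff_X_mul_derivative, coeff_eq_zero_of_natDegree_lt, mul_zero]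
  rw [hP.natDegree_eq]
  exact hk

theorem nextCoeff_succ (hP : IsMonicOrthogonal L P h) (n : ℕ) :
    (P (n + 1)).nextCoeff = (P (n + 1)).coeff n := by
  rw [nextCoeff_of_natDegree_pos] <;> simp [hP.natDegree_eq]

theorem coeff_X_mul_self (hP : IsMonicOrthogonal L P h) (n : ℕ) :
    (X * P n).coeff n = (P n).nextCoeff := by
  cases n with
  | zero => simp [nextCoeff, hP.natDegree_eq]
  | succ n => rw [coeff_X_mul, hP.nextCoeff_succ]

theorem coeff_X_mul_X_mul_derivative_self (hP : IsMonicOrthogonal L P h) (n : ℕ) :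
    (X * (X * derivative (P n))).coeff n = (n - 1) * (P n).nextCoeff := by
  cases n with
  | zero => simp [nextCoeff, hP.natDegree_eq]
  | succ n => rw [coeff_X_mul, coeff_X_mul_derivative, hP.nextCoeff_succ]; simp

theorem degree_lt_succ (hP : IsMonicOrthogonal L P h) (n : ℕ) :
    (P n).degree < ((n + 1 : ℕ) : WithBot ℕ) := by
  rw [hP.degree_eq]
  exact_mod_cast Nat.lt_succ_self n

theorem apply_self_mul_X_mul_self (hP : IsMonicOrthogonal L P h) (n : ℕ) :
    L (P n * (X * P n)) = ((P n).nextCoeff - (P (n + 1)).nextCoeff) * h n := by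
  rw [hP.apply_mul_of_degree_lt_add_two (degree_X_mul_lt (hP.degree_lt_succ n)),
    hP.coeff_X_mul_self, coeff_X_mul, hP.coeff_self, hP.nextCoeff_succ, one_mul]

theorem apply_self_mul_X_mul_derivative (hP : IsMonicOrthogonal L P h) (n : ℕ) :
    L (P n * (X * derivative (P n))) = n * h n := by
  rw [hP.apply_mul_of_degree_lt_add_two ((hP.degree_X_mul_derivative_lt n).trans
    (by exact_mod_cast Nat.lt_succ_self _)), coeff_X_mul_derivative, coeff_X_mul_derivative,
    hP.coeff_self, coeff_eq_zero_of_natDegree_lt (n := n + 1) (by simp [hP.natDegree_eq])]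
  ring

theorem apply_self_mul_X_mul_X_mul_derivative (hP : IsMonicOrthogonal L P h) (n : ℕ) :
    L (P n * (X * (X * derivative (P n)))) =
      ((n - 1) * (P n).nextCoeff - n * (P (n + 1)).nextCoeff) * h n := by
  rw [hP.apply_mul_of_degree_lt_add_two (degree_X_mul_lt (hP.degree_X_mul_derivative_lt n)),
    hP.coeff_X_mul_X_mul_derivative_self, coeff_X_mul, coeff_X_mul_derivative, hP.coeff_self,
    hP.nextCoeff_succ, mul_one]

theorem apply_mul_derivative_succ (hP : IsMonicOrthogonal L P h) (n : ℕ) :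
    L (P n * derivative (P (n + 1))) = (n + 1) * h n := by
  have hd : (derivative (P (n + 1))).degree < ((n + 2 : ℕ) : WithBot ℕ) :=
    (degree_derivative_le).trans_lt (hP.degree_lt_succ (n + 1))
  rw [hP.apply_mul_of_degree_lt_add_two hd, coeff_derivative, coeff_derivative, hP.coeff_self,
    coeff_eq_zero_of_natDegree_lt (n := n + 1 + 1) (by simp [hP.natDegree_eq])]
  ring

theorem apply_mul_X_mul_derivative_succ (hP : IsMonicOrthogonal L P h) (n : ℕ) :
    L (P n * (X * derivative (P (n + 1)))) = -(P (n + 1)).nextCoeff * h n := by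
  rw [hP.apply_mul_of_degree_lt_add_two (hP.degree_X_mul_derivative_lt (n + 1)),
    coeff_X_mul_derivative, coeff_X_mul_derivative, hP.coeff_self, hP.nextCoeff_succ]
  push_cast
  ring

/-- The Hankel determinant of a functional is the product of the squared norms. -/
theorem det_hankel (hP : IsMonicOrthogonal L P h) (n : ℕ) :
    (Matrix.of fun j k : Fin n => L (X ^ ((j : ℕ) + (k : ℕ)))).det = ∏ j : Fin n, h j := by
  set A : Matrix (Fin n) (Fin n) ℝ := Matrix.of fun i j => (P j).coeff i with hA
  have hdet : A.det = 1 := Matrix.det_matrixOfPolynomials (fun j : Fin n => P j)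
    (fun i => hP.natDegree_eq i) (fun i => hP.monic i)
  have hexp (i : Fin n) : P i = ∑ j : Fin n, A j i • X ^ (j : ℕ) := by
    conv_lhs => rw [as_sum_range' (P i) n (by rw [hP.natDegree_eq]; exact i.2)]
    rw [← Fin.sum_univ_eq_sum_range (fun k => monomial k ((P i).coeff k))]
    exact Finset.sum_congr rfl fun j _ => by rw [← C_mul_X_pow_eq_monomial, ← smul_eq_C_mul]; rfl
  have key : A.transpose * (Matrix.of fun j k : Fin n => L (X ^ ((j : ℕ) + (k : ℕ)))) * A =
      Matrix.diagonal fun j : Fin n => h j := by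
    ext i l
    have h1 : L (P i * P l) = if i = l then h l else 0 := by
      rw [hP.apply_mul]; simp [Fin.ext_iff]
    rw [Matrix.diagonal_apply]
    rw [show (if i = l then h i else 0) = if i = l then h l else 0 by split_ifs with e <;> simp [e],
      ← h1, hexp i, hexp l, Finset.sum_mul_sum]
    simp only [Matrix.mul_apply, Matrix.transpose_apply, Matrix.of_apply,
      map_sum, smul_mul_smul_comm, map_smul, smul_eq_mul, ← pow_add, Finset.sum_mul]
    rw [Finset.sum_comm]
    exact Finset.sum_congr rfl fun _ _ => Finset.sum_congr rfl fun _ _ => by ring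
  have := congrArg Matrix.det key
  simpa [Matrix.det_mul, hdet, Matrix.det_diagonal] using this

end IsMonicOrthogonal

theorem differentiableAt_matrix_det {n : ℕ} {A : ℝ → Matrix (Fin n) (Fin n) ℝ} {t : ℝ}
    (hA : ∀ i j, DifferentiableAt ℝ (fun s => A s i j) t) :
    DifferentiableAt ℝ (fun s => (A s).det) t := by
  simp_rw [Matrix.det_apply]
  refine DifferentiableAt.fun_sum fun σ _ => DifferentiableAt.const_smul ?_ _
  exact DifferentiableAt.fun_finsetProd fun i _ => hA _ _

theorem Polynomial.Monic.eq_X_pow_add_sum_smul {Q : ℝ[X]} (hQ : Q.Monic) :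
    Q = X ^ Q.natDegree + ∑ k : Fin Q.natDegree, Q.coeff k • X ^ (k : ℕ) := by
  conv_lhs => rw [hQ.as_sum]
  rw [Fin.sum_univ_eq_sum_range (fun k => Q.coeff k • (X : ℝ[X]) ^ k)]
  simp_rw [smul_eq_C_mul]

theorem IsMonicOrthogonal.eq_X_pow_add_sum_smul {L : ℝ[X] →ₗ[ℝ] ℝ} {P : ℕ → ℝ[X]}
    {h : ℕ → ℝ} (hP : IsMonicOrthogonal L P h) (n : ℕ) :
    P n = X ^ n + ∑ k : Fin n, (P n).coeff k • X ^ (k : ℕ) := by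
  have := (hP.monic n).eq_X_pow_add_sum_smul
  rwa [hP.natDegree_eq] at this

section Family

variable {L : ℝ → ℝ[X] →ₗ[ℝ] ℝ} {P : ℝ → ℕ → ℝ[X]} {h : ℝ → ℕ → ℝ} {t : ℝ}

/-- The coefficients of the monic orthogonal polynomials depend differentiably on a parameter
as soon as the moments do. -/
theorem differentiableAt_coeff_of_isMonicOrthogonal
    (hL : ∀ Q, DifferentiableAt ℝ (fun s => L s Q) t)
    (hP : ∀ᶠ s in 𝓝 t, IsMonicOrthogonal (L s) (P s) (h s) ∧ ∀ n, h s n ≠ 0)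
    (n : ℕ) (k : Fin n) : DifferentiableAt ℝ (fun s => (P s n).coeff k) t := by
  set M : ℝ → Matrix (Fin n) (Fin n) ℝ :=
    fun s => Matrix.of fun j k => L s (X ^ ((j : ℕ) + (k : ℕ))) with hM
  set b : ℝ → Fin n → ℝ := fun s j => -L s (X ^ ((j : ℕ) + n)) with hb
  have hdet {s : ℝ} (hs : IsMonicOrthogonal (L s) (P s) (h s) ∧ ∀ n, h s n ≠ 0) :
      (M s).det ≠ 0 := by
    rw [hM, hs.1.det_hankel n]
    exact Finset.prod_ne_zero_iff.2 fun j _ => hs.2 j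
  have hdiff : DifferentiableAt ℝ (fun s => ((M s).updateCol k (b s)).det / (M s).det) t := by
    refine DifferentiableAt.div (differentiableAt_matrix_det fun i j => ?_)
      (differentiableAt_matrix_det fun i j => hL _) (hdet hP.self_of_nhds)
    by_cases hj : j = k
    · simpa [Matrix.updateCol_apply, hj, hb] using (hL _).neg
    · simpa [Matrix.updateCol_apply, hj, hM] using hL _
  refine hdiff.congr_of_eventuallyEq (hP.mono fun s hs => ?_)
  have hsys : (M s).mulVec (fun k : Fin n => (P s n).coeff k) = b s := by
    ext j
    have h1 : L s (P s n * X ^ (j : ℕ)) = 0 :=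
      hs.1.apply_mul_of_degree_lt (by rw [degree_X_pow]; exact_mod_cast j.2)
    rw [hs.1.eq_X_pow_add_sum_smul n, add_mul, Finset.sum_mul] at h1
    simp only [map_add, map_sum, smul_mul_assoc, map_smul, smul_eq_mul, ← pow_add] at h1
    simp only [hM, hb, Matrix.mulVec, dotProduct, Matrix.of_apply]
    rw [eq_neg_iff_add_eq_zero, add_comm, add_comm (j : ℕ) n, ← h1]
    congr 1
    exact Finset.sum_congr rfl fun k _ => by rw [mul_comm, add_comm]
  change (P s n).coeff k = _
  rw [eq_div_iff (hdet hs), ← Matrix.cramer_apply, ← hsys, Matrix.cramer_eq_adjugate_mulVec,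
    Matrix.mulVec_mulVec, Matrix.adjugate_mul]
  simp [Matrix.smul_mulVec, mul_comm]

/-- Product rule for `s ↦ L s (P s n * Q)`. -/
theorem hasDerivAt_apply_mul_of_isMonicOrthogonal {L' : ℝ[X] →ₗ[ℝ] ℝ}
    (hL : ∀ Q, HasDerivAt (fun s => L s Q) (L' Q) t)
    (hP : ∀ᶠ s in 𝓝 t, IsMonicOrthogonal (L s) (P s) (h s) ∧ ∀ n, h s n ≠ 0)
    (n : ℕ) (Q : ℝ[X]) :
    HasDerivAt (fun s => L s (P s n * Q))
      (∑ k : Fin n, deriv (fun s => (P s n).coeff k) t * L t (X ^ (k : ℕ) * Q)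
        + L' (P t n * Q)) t := by
  have hexp {s : ℝ} (hs : IsMonicOrthogonal (L s) (P s) (h s)) (Λ : ℝ[X] →ₗ[ℝ] ℝ) :
      Λ (P s n * Q) =
        Λ (X ^ n * Q) + ∑ k : Fin n, (P s n).coeff k * Λ (X ^ (k : ℕ) * Q) := by
    conv_lhs => rw [hs.eq_X_pow_add_sum_smul n]
    simp [add_mul, Finset.sum_mul]
  have hc (k : Fin n) := (differentiableAt_coeff_of_isMonicOrthogonal
    (fun Q => (hL Q).differentiableAt) hP n k).hasDerivAt
  have key := (hL (X ^ n * Q)).fun_add (HasDerivAt.fun_sum (u := Finset.univ)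
    fun k _ => (hc k).fun_mul (hL (X ^ (k : ℕ) * Q)))
  refine (key.congr_of_eventuallyEq (hP.mono fun s hs => hexp hs.1 (L s))).congr_deriv ?_
  rw [hexp hP.self_of_nhds.1 L', Finset.sum_add_distrib]
  ring

theorem hasDerivAt_sqNorm_of_isMonicOrthogonal {L' : ℝ[X] →ₗ[ℝ] ℝ}
    (hL : ∀ Q, HasDerivAt (fun s => L s Q) (L' Q) t)
    (hP : ∀ᶠ s in 𝓝 t, IsMonicOrthogonal (L s) (P s) (h s) ∧ ∀ n, h s n ≠ 0) (n : ℕ) :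
    HasDerivAt (fun s => h s n) (L' (P t n * P t n)) t := by
  have ht := hP.self_of_nhds.1
  refine ((hasDerivAt_apply_mul_of_isMonicOrthogonal hL hP n (P t n)).congr_of_eventuallyEq
    (hP.mono fun s hs => ?_)).congr_deriv ?_
  · have hd : (P t n).degree < ((n + 2 : ℕ) : WithBot ℕ) :=
      (ht.degree_lt_succ n).trans (by exact_mod_cast Nat.lt_succ_self _)
    simp only [hs.1.apply_mul_of_degree_lt_add_two hd, ht.coeff_self]
    rw [coeff_eq_zero_of_natDegree_lt (by simp [ht.natDegree_eq])]
    ring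
  · rw [Finset.sum_eq_zero, zero_add]
    intro k _
    rw [mul_comm (X ^ (k : ℕ)), ht.apply_mul_of_degree_lt, mul_zero]
    rw [degree_X_pow]
    exact_mod_cast k.2

theorem hasDerivAt_nextCoeff_of_isMonicOrthogonal {L' : ℝ[X] →ₗ[ℝ] ℝ}
    (hL : ∀ Q, HasDerivAt (fun s => L s Q) (L' Q) t)
    (hP : ∀ᶠ s in 𝓝 t, IsMonicOrthogonal (L s) (P s) (h s) ∧ ∀ n, h s n ≠ 0) (n : ℕ) :
    HasDerivAt (fun s => (P s (n + 1)).nextCoeff) (-L' (P t n * P t (n + 1)) / h t n) t := by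
  obtain ⟨ht, hn⟩ := hP.self_of_nhds
  have hc := (differentiableAt_coeff_of_isMonicOrthogonal
    (fun Q => (hL Q).differentiableAt) hP (n + 1) (Fin.last n)).hasDerivAt
  refine (hc.congr_of_eventuallyEq (hP.mono fun s hs => ?_)).congr_deriv ?_
  · simpa using hs.1.nextCoeff_succ n
  have h0 := hasDerivAt_apply_mul_of_isMonicOrthogonal hL hP (n + 1) (P t n)
  have h1 : HasDerivAt (fun s => L s (P s (n + 1) * P t n)) 0 t := by
    refine (hasDerivAt_const t (0:ℝ)).congr_of_eventuallyEq (hP.mono fun s hs => ?_)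
    exact hs.1.apply_mul_of_degree_lt (ht.degree_lt_succ n)
  have h2 := h0.unique h1
  rw [Fin.sum_univ_castSucc, Finset.sum_eq_zero, zero_add] at h2
  · have h3 : L t (X ^ ((Fin.last n : Fin (n + 1)) : ℕ) * P t n) = h t n := by
      rw [mul_comm, ht.apply_mul_of_degree_lt_add_two]
      · simp [coeff_X_pow]
      · rw [degree_X_pow]
        exact_mod_cast (by simp : ((Fin.last n : Fin (n + 1)) : ℕ) < n + 2)
    rw [h3, mul_comm (P t (n + 1))] at h2
    rw [eq_div_iff (hn n)]
    linarith
  · intro k _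
    rw [mul_comm (X ^ _), ht.apply_mul_of_degree_lt, mul_zero]
    rw [degree_X_pow]
    exact_mod_cast k.2

end Family

section Jacobi

variable {α β γ t : ℝ} {P : ℕ → ℝ[X]} {h : ℕ → ℝ}

theorem IsMonicOrthogonal.jacobi_sum_eq_zero (hα : 0 < α) (hβ : 0 < β) (ht : t < 0)
    (hP : IsMonicOrthogonal (jacobiFunctional α β γ t) P h) (n : ℕ) :
    (n + 1) * h n + γ * jacobiFunctional α β (γ - 1) t (P n * P (n + 1))
      + α * jacobiFunctional (α - 1) β γ t (P n * P (n + 1))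
      - β * jacobiFunctional α (β - 1) γ t (P n * P (n + 1)) = 0 := by
  have key := jacobiFunctional_derivative (γ := γ) hα hβ ht (P n * P (n + 1))
  have h1 : jacobiFunctional α β γ t (P (n + 1) * derivative (P n)) = 0 :=
    hP.apply_mul_of_degree_lt (degree_derivative_le.trans_lt (hP.degree_lt_succ n))
  rwa [derivative_mul, map_add, mul_comm (derivative (P n)), h1, hP.apply_mul_derivative_succ,
    zero_add] at key

theorem IsMonicOrthogonal.jacobi_eq_nextCoeff (hα : 0 < α) (hβ : 0 < β) (ht : t < 0)
    (hP : IsMonicOrthogonal (jacobiFunctional α β γ t) P h) (n : ℕ) :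
    β * jacobiFunctional α (β - 1) γ t (P n * P (n + 1)) =
      t * (γ * jacobiFunctional α β (γ - 1) t (P n * P (n + 1)))
        - (P (n + 1)).nextCoeff * h n := by
  set Q := P n * P (n + 1) with hQ
  have key := jacobiFunctional_derivative (γ := γ) hα hβ ht (X * Q)
  have hL : jacobiFunctional α β γ t Q = 0 := by simp [hQ, hP.apply_mul]
  have h1 : jacobiFunctional α β γ t (P (n + 1) * (X * derivative (P n))) = 0 :=
    hP.apply_mul_of_degree_lt (hP.degree_X_mul_derivative_lt n)
  have h2 : derivative (X * Q) =
      Q + P (n + 1) * (X * derivative (P n)) + P n * (X * derivative (P (n + 1))) := by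
    rw [hQ]; simp only [derivative_mul, derivative_X]; ring
  have h3 : X * Q = (X - C t) * Q + t • Q := by rw [smul_eq_C_mul]; ring
  have h4 : X * Q = Q - (1 - X) * Q := by ring
  rw [h2, map_add, map_add, hL, h1, hP.apply_mul_X_mul_derivative_succ,
    jacobiFunctional_X_mul hα (by linarith) ht, hL] at key
  rw [h3, map_add, map_smul, jacobiFunctional_X_sub_C_mul (by linarith) (by linarith) ht, hL,
    ← h3, h4, map_sub, jacobiFunctional_one_sub_X_mul (by linarith) hβ ht, hL, smul_eq_mul] at key
  linarith

theorem IsMonicOrthogonal.jacobi_sq_eq (hα : 0 < α) (hβ : 0 < β) (ht : t < 0)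
    (hP : IsMonicOrthogonal (jacobiFunctional α β γ t) P h) (n : ℕ) :
    t * (t - 1) * (-γ * jacobiFunctional α β (γ - 1) t (P n * P n)) =
      (((2 * n + α + β + γ) * (P n).nextCoeff + n ^ 2 + α * n - γ * (t - 1) * n)
        - ((2 * (n + 1) + α + β + γ) * (P (n + 1)).nextCoeff + (n + 1) ^ 2 + α * (n + 1)
          - γ * (t - 1) * (n + 1))) * h n := by
  set Q := P n * P n with hQ
  set L := jacobiFunctional α β γ t with hL
  have key := jacobiFunctional_derivative (γ := γ) hα hβ ht (X * ((1 - X) * Q))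
  rw [← hL] at key
  have e0 : L Q = h n := by simp [hQ, hP.apply_mul]
  have e1 : L (X * Q) = ((P n).nextCoeff - (P (n + 1)).nextCoeff) * h n := by
    rw [← hP.apply_self_mul_X_mul_self, hQ]; congr 1; ring
  have hd : derivative (X * ((1 - X) * Q)) = Q - (2:ℝ) • (X * Q)
      + (2:ℝ) • (P n * (X * derivative (P n)))
      - (2:ℝ) • (P n * (X * (X * derivative (P n)))) := by
    rw [hQ]
    simp only [derivative_mul, derivative_X, derivative_sub, derivative_one, smul_eq_C_mul,
      map_ofNat]
    ring
  have hγ : X * ((1 - X) * Q) = (X - C t) * ((1 - t) • Q - X * Q) - (t * (t - 1)) • Q := by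
    simp only [smul_eq_C_mul, C_mul, C_sub, C_1]; ring
  have hα1 : (1 - X) * Q = Q - X * Q := by ring
  have f1 : jacobiFunctional α β (γ - 1) t (X * ((1 - X) * Q)) =
      (1 - t) * L Q - L (X * Q) - t * (t - 1) * jacobiFunctional α β (γ - 1) t Q := by
    rw [hγ, map_sub, jacobiFunctional_X_sub_C_mul (by linarith) (by linarith) ht]
    simp [hL]
  have f2 : jacobiFunctional (α - 1) β γ t (X * ((1 - X) * Q)) = L Q - L (X * Q) := by
    rw [jacobiFunctional_X_mul hα (by linarith) ht, hα1, map_sub]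
  have f3 : jacobiFunctional α (β - 1) γ t (X * ((1 - X) * Q)) = L (X * Q) := by
    rw [mul_left_comm, jacobiFunctional_one_sub_X_mul (by linarith) hβ ht]
  rw [hd, f1, f2, f3] at key
  simp only [map_add, map_sub, map_smul, smul_eq_mul, hP.apply_self_mul_X_mul_derivative,
    hP.apply_self_mul_X_mul_X_mul_derivative, e0, e1] at key
  linear_combination key

theorem hankelDet_eq_det (α β γ : ℝ) (n : ℕ) (t : ℝ) :
    hankelDet α β γ n t = (Matrix.of fun j k : Fin n =>
      jacobiFunctional α β γ t (X ^ ((j : ℕ) + (k : ℕ)))).det := by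
  simp_rw [jacobiFunctional_X_pow]
  rfl

end Jacobi

section JacobiFamily

variable {α β γ : ℝ} {P : ℝ → ℕ → ℝ[X]} {h : ℝ → ℕ → ℝ}

theorem deriv_log_hankelDet (hα : 0 < α) (hβ : 0 < β)
    (hP : ∀ t < 0, IsMonicOrthogonal (jacobiFunctional α β γ t) (P t) (h t))
    (hpos : ∀ t < 0, ∀ n, 0 < h t n) (n : ℕ) {t : ℝ} (ht : t < 0) :
    t * (t - 1) * deriv (fun s => Real.log (hankelDet α β γ n s)) t =
      -((2 * n + α + β + γ) * (P t n).nextCoeff) - n * (n + α + γ) + γ * n * t := by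
  have hev : ∀ᶠ s in 𝓝 t, IsMonicOrthogonal (jacobiFunctional α β γ s) (P s) (h s) ∧
      ∀ n, h s n ≠ 0 := by
    filter_upwards [Iio_mem_nhds ht] with s hs
    exact ⟨hP s hs, fun n => (hpos s hs n).ne'⟩
  have hlog : HasDerivAt (fun s => Real.log (hankelDet α β γ n s))
      (∑ j ∈ Finset.range n,
        (-γ * jacobiFunctional α β (γ - 1) t (P t j * P t j)) / h t j) t := by
    have hsum := HasDerivAt.fun_sum (u := Finset.range n) fun j _ =>
      (hasDerivAt_sqNorm_of_isMonicOrthogonal (L' := -γ • jacobiFunctional α β (γ - 1) t)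
        (fun Q => hasDerivAt_jacobiFunctional (by linarith) (by linarith) ht Q) hev j).log
        (hpos t ht j).ne'
    refine hsum.congr_of_eventuallyEq (hev.mono fun s hs => ?_)
    change Real.log (hankelDet α β γ n s) = _
    rw [hankelDet_eq_det, hs.1.det_hankel, Fin.prod_univ_eq_prod_range (h s),
      Real.log_prod fun j _ => hs.2 j]
  set F : ℕ → ℝ := fun j => (2 * j + α + β + γ) * (P t j).nextCoeff + j ^ 2 + α * j
    - γ * (t - 1) * j with hF
  have hterm (j : ℕ) :
      t * (t - 1) * ((-γ * jacobiFunctional α β (γ - 1) t (P t j * P t j)) / h t j) =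
        F j - F (j + 1) := by
    rw [← mul_div_assoc, (hP t ht).jacobi_sq_eq hα hβ ht, mul_div_cancel_right₀ _ (hpos t ht j).ne']
    simp [hF]
  rw [hlog.deriv, Finset.mul_sum, Finset.sum_congr rfl fun j _ => hterm j, Finset.sum_range_sub']
  have h0 : (P t 0).nextCoeff = 0 := by simp [nextCoeff, (hP t ht).natDegree_eq]
  simp only [hF, h0]
  push_cast
  ring

end JacobiFamily

theorem statement18
    (α β γ : ℝ) (hα : 0 < α) (hβ : 0 < β)
    (P : ℝ → ℕ → Polynomial ℝ) (h : ℝ → ℕ → ℝ)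
    (hmonic : ∀ t < (0:ℝ), ∀ n, (P t n).Monic ∧ (P t n).natDegree = n)
    (hpos : ∀ t < (0:ℝ), ∀ n, 0 < h t n)
    (horth : ∀ t < (0:ℝ), ∀ m n, (∫ x in (0:ℝ)..1,
        (P t m).eval x * (P t n).eval x * genJacobiWeight α β γ t x)
      = if m = n then h t n else 0)
    (r rs : ℝ → ℕ → ℝ)
    (hr : ∀ t < (0:ℝ), ∀ n, 1 ≤ n → r t n = β / h t (n - 1) *
      ∫ y in (0:ℝ)..1, (P t (n - 1)).eval y * (P t n).eval y
        * genJacobiWeight α β γ t y / (1 - y))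
    (hrs : ∀ t < (0:ℝ), ∀ n, 1 ≤ n → rs t n = α / h t (n - 1) *
      ∫ y in (0:ℝ)..1, (P t (n - 1)).eval y * (P t n).eval y
        * genJacobiWeight α β γ t y / y)
    (n : ℕ) (hn : 1 ≤ n) (hne : 2 * (n : ℝ) + α + β + γ ≠ 0)
    (H : ℝ → ℝ)
    (hH : ∀ t < (0:ℝ),
      H t = t * (t - 1) * deriv (fun s => Real.log (hankelDet α β γ n s)) t) :
    ∀ t < (0:ℝ),
      rs t n = -((n * (n + β + γ) + (t - 1) * deriv H t - H t) / (2 * n + α + β + γ)) ∧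
      r t n = (n * (n + α + γ) - t * deriv H t + H t) / (2 * n + α + β + γ) := by
  have hα' : -1 < α := by linarith
  have hβ' : -1 < β := by linarith
  have hP : ∀ t < 0, IsMonicOrthogonal (jacobiFunctional α β γ t) (P t) (h t) := fun t ht =>
    { monic := fun n => (hmonic t ht n).1
      natDegree_eq := fun n => (hmonic t ht n).2
      apply_mul := fun m n => by
        simpa [jacobiFunctional_eq_integral hα' hβ' ht] using horth t ht m n }
  obtain ⟨m, rfl⟩ : ∃ m, n = m + 1 := ⟨n - 1, by omega⟩
  intro t ht
  have hm := (hpos t ht m).ne'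
  set T := γ * jacobiFunctional α β (γ - 1) t (P t m * P t (m + 1)) / h t m with hT
  have hrs' : rs t (m + 1) =
      α * jacobiFunctional (α - 1) β γ t (P t m * P t (m + 1)) / h t m := by
    rw [hrs t ht _ hn, jacobiFunctional_eq_integral (by linarith) hβ' ht, mul_div_right_comm]
    congr 1
    refine intervalIntegral.integral_congr_Ioo_of_le zero_le_one fun x hx => ?_
    simp [genJacobiWeight_sub_one_left hx.1, mul_div_assoc]
  have hr' : r t (m + 1) =
      β * jacobiFunctional α (β - 1) γ t (P t m * P t (m + 1)) / h t m := by
    rw [hr t ht _ hn, jacobiFunctional_eq_integral hα' (by linarith) ht, mul_div_right_comm]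
    congr 1
    refine intervalIntegral.integral_congr_Ioo_of_le zero_le_one fun x hx => ?_
    simp [genJacobiWeight_sub_one_right hx.2, mul_div_assoc]
  have eqA : (m + 1) + T + rs t (m + 1) - r t (m + 1) = 0 := by
    rw [hT, hrs', hr']
    field_simp
    linear_combination (hP t ht).jacobi_sum_eq_zero hα hβ ht m
  have eqB : r t (m + 1) = t * T - (P t (m + 1)).nextCoeff := by
    rw [hT, hr', (hP t ht).jacobi_eq_nextCoeff hα hβ ht m]
    field_simp
  have hH' (s : ℝ) (hs : s < 0) : H s = -((2 * ((m + 1 : ℕ) : ℝ) + α + β + γ)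
      * (P s (m + 1)).nextCoeff) - ((m + 1 : ℕ) : ℝ) * (((m + 1 : ℕ) : ℝ) + α + γ)
        + γ * ((m + 1 : ℕ) : ℝ) * s := by
    rw [hH s hs, deriv_log_hankelDet hα hβ hP hpos (m + 1) hs]
  have hev : ∀ᶠ s in 𝓝 t, IsMonicOrthogonal (jacobiFunctional α β γ s) (P s) (h s) ∧
      ∀ n, h s n ≠ 0 := by
    filter_upwards [Iio_mem_nhds ht] with s hs
    exact ⟨hP s hs, fun n => (hpos s hs n).ne'⟩
  have hp : HasDerivAt (fun s => (P s (m + 1)).nextCoeff) T t :=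
    (hasDerivAt_nextCoeff_of_isMonicOrthogonal (L' := -γ • jacobiFunctional α β (γ - 1) t)
      (fun Q => hasDerivAt_jacobiFunctional hα' hβ' ht Q) hev m).congr_deriv (by simp [hT])
  have hderiv : deriv H t = -((2 * ((m + 1 : ℕ) : ℝ) + α + β + γ) * T)
      + γ * ((m + 1 : ℕ) : ℝ) := by
    have h1 := (((hp.const_mul (2 * ((m + 1 : ℕ) : ℝ) + α + β + γ)).fun_neg.sub_const
      (((m + 1 : ℕ) : ℝ) * (((m + 1 : ℕ) : ℝ) + α + γ))).fun_add
        ((hasDerivAt_id t).const_mul (γ * ((m + 1 : ℕ) : ℝ))))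
    rw [(h1.congr_of_eventuallyEq (f₁ := H) ?_).deriv, mul_one]
    filter_upwards [Iio_mem_nhds ht] with s hs
    exact hH' s hs
  rw [hderiv, hH' t ht]
  push_cast at hne ⊢
  constructor
  · rw [← neg_div, eq_div_iff hne]
    linear_combination (2 * ((m : ℝ) + 1) + α + β + γ) * (eqA + eqB)
  · rw [eq_div_iff hne]
    linear_combination (2 * ((m : ℝ) + 1) + α + β + γ) * eqB
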